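/- Let {X_n} be a stationary and ergodic time series with values in a finite or countably infinite set 𝒳 whose conditional expectation F(X⁰_{−∞}) = E(f(X_1)|X⁰_{−∞}) is almost surely continuous, and suppose κ_j → ∞ almost surely. Then almost surely X̃⁰_{−∞} belongs to the random neighbourhood 𝒩_j(X_0^{λ_j}) for every j, and lim_{j→∞} |E(f(X_{λ_j+1}) | X_0^{λ_j}) − F(X̃⁰_{−∞})| = 0. -/

import Mathlib

open MeasureTheory Filter Set
open scoped ENNReal Topology

noncomputable section

namespace MWPrediction

/-- The canonical two-sided path space for a process with values in `𝒳`. -/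
abbrev Path (𝒳 : Type*) := ℤ → 𝒳

variable {𝒳 : Type*}

/-- The left shift `(T ω) i = ω (i+1)` on two-sided sequences. -/
def shift (ω : Path 𝒳) : Path 𝒳 := fun i => ω (i + 1)

/-- The one-sided past `X⁰_{-∞}`, recorded as `past ω i = X_{-i}`. -/
def past (ω : Path 𝒳) : ℕ → 𝒳 := fun i => ω (-(i : ℤ))

/-- The string `s` of length `m` (read right-to-left: `s j` is the symbol at
position `t - j`) occurs in `ω` ending at time `t`. -/
def OccursAt (ω : Path 𝒳) (m : ℕ) (s : ℕ → 𝒳) (t : ℤ) : Prop :=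
  ∀ j < m, ω (t - (j : ℤ)) = s j

/-- The auxiliary stopping times `ζ_n`:  `ζ_0 = 0` and `ζ_n` is obtained from
`ζ_{n-1}` by waiting for the recurrence of the block of length `l n` ending
at `ζ_{n-1}`. -/
def zeta (l : ℕ → ℕ) (ω : Path 𝒳) : ℕ → ℤ
  | 0 => 0
  | n + 1 =>
    zeta l ω n +
      ((sInf {t : ℕ | 0 < t ∧ ∀ s < l (n + 1),
          ω (zeta l ω n - (s : ℤ) + (t : ℤ)) = ω (zeta l ω n - (s : ℤ))} : ℕ) : ℤ)

/-- `J n = min { j ≥ 1 : l (j+1) > n }`. -/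
def Jfun (l : ℕ → ℕ) (n : ℕ) : ℕ := sInf {j : ℕ | 1 ≤ j ∧ n < l (j + 1)}

/-- The auxiliary process `X̃`: `tildePast l ω i = X̃_{-i} = X_{ζ_{J(i)} - i}`. -/
def tildePast (l : ℕ → ℕ) (ω : Path 𝒳) : ℕ → 𝒳 :=
  fun i => ω (zeta l ω (Jfun l i) - (i : ℤ))

variable [MeasurableSpace 𝒳]

/-- `pstr μ m s = P(X_{-m+1}^0 = s)`, the probability that the string `s` of
length `m` (read right-to-left) occupies positions `-m+1, …, 0`.
(So `pstr μ (k+1)` is `p_k` of the paper.) -/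
def pstr (μ : Measure (Path 𝒳)) (m : ℕ) (s : ℕ → 𝒳) : ℝ :=
  (μ {ω | ∀ j < m, ω (-(j : ℤ)) = s j}).toReal

/-- `pcond μ m y s = P(X_1 = y | X_{-m+1}^0 = s)`, conditioning on `m` symbols.
(So `pcond μ m` is `p_{m-1}(·|·)` of the paper.) -/
def pcond (μ : Measure (Path 𝒳)) (m : ℕ) (y : 𝒳) (s : ℕ → 𝒳) : ℝ :=
  (μ {ω | ω 1 = y ∧ ∀ j < m, ω (-(j : ℤ)) = s j}).toReal / pstr μ m s

/-- Append `y` as the new rightmost symbol of the string `s`. -/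
def withLast (y : 𝒳) (s : ℕ → 𝒳) : ℕ → 𝒳 := fun j => if j = 0 then y else s (j - 1)

/-- The string which agrees with `b` on its rightmost `k` symbols and continues
to the left with `z`:  this is the string `(z, b_{-k+1}^0)` of the paper. -/
def prependOld (b : ℕ → 𝒳) (k : ℕ) (z : ℕ → 𝒳) : ℕ → 𝒳 :=
  fun j => if j < k then b j else z (j - k)

/-- `K` is a memory bound for the past `b`: for all `i ≥ 1`, `y` and `z ∈ 𝒳^i`,
if `p_{K+i}(z, b_{-K+1}^0, y) > 0` then
`p_{K-1}(y | b_{-K+1}^0) = p_{K+i-1}(y | z, b_{-K+1}^0)`. -/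
def IsMemoryBound (μ : Measure (Path 𝒳)) (b : ℕ → 𝒳) (K : ℕ) : Prop :=
  ∀ i : ℕ, 1 ≤ i → ∀ y : 𝒳, ∀ z : ℕ → 𝒳,
    0 < pstr μ (K + i + 1) (withLast y (prependOld b K z)) →
    pcond μ K y b = pcond μ (K + i) y (prependOld b K z)

/-- The (random) memory length `K(b)` of a one-sided path `b`: the smallest
memory bound, and `∞` if there is none. -/
def memLen (μ : Measure (Path 𝒳)) (b : ℕ → 𝒳) : ℕ∞ :=
  sInf {n : ℕ∞ | ∃ K : ℕ, n = (K : ℕ∞) ∧ IsMemoryBound μ b K}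

/-- `Δ_k(b_{-k+1}^0)`. -/
def Delta (μ : Measure (Path 𝒳)) (k : ℕ) (b : ℕ → 𝒳) : ℝ :=
  sSup {d : ℝ | ∃ i : ℕ, 1 ≤ i ∧ ∃ z : ℕ → 𝒳, ∃ x : 𝒳,
    0 < pstr μ (k + i + 1) (withLast x (prependOld b k z)) ∧
    d = |pcond μ k x b - pcond μ (k + i) x (prependOld b k z)|}

/-- `⌈n/2⌉`. -/
def half (n : ℕ) : ℕ := (n + 1) / 2

open Classical in
/-- The number of times `t ∈ [a, b]` at which the string `s` of length `m`
occurs in `ω` ending at `t`. -/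
def cnt (ω : Path 𝒳) (m : ℕ) (s : ℕ → 𝒳) (a b : ℤ) : ℕ :=
  ((Finset.Icc a b).filter fun t => OccursAt ω m s t).card

/-- Membership in `ℒ_{n,m}^{(1)}`: the string `s` of length `m+1` occurs in
`X_0^{⌈n/2⌉ - 1}`. -/
def inL1 (ω : Path 𝒳) (n m : ℕ) (s : ℕ → 𝒳) : Prop :=
  ∃ t : ℤ, (m : ℤ) ≤ t ∧ t ≤ (half n : ℤ) - 1 ∧ OccursAt ω (m + 1) s t

/-- Membership in `ℒ_{n,m}^{(2)}`: the string `s` of length `m+1` occurs more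
than `n^{1-γ}` times in `X_{⌈n/2⌉}^n`. -/
def inL2 (γ : ℝ) (ω : Path 𝒳) (n m : ℕ) (s : ℕ → 𝒳) : Prop :=
  (n : ℝ) ^ (1 - γ) < (cnt ω (m + 1) s ((half n : ℤ) + (m : ℤ)) (n : ℤ) : ℝ)

/-- Membership in `ℒ_m^n = ℒ_{n,m}^{(1)} ∩ ℒ_{n,m}^{(2)}`. -/
def inL (γ : ℝ) (ω : Path 𝒳) (n m : ℕ) (s : ℕ → 𝒳) : Prop :=
  inL1 ω n m s ∧ inL2 γ ω n m s

/-- The empirical conditional relative frequency of `x` following the string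
`s` of length `m`, computed in the second half `X_{⌈n/2⌉}^n` of the data. -/
def empCond (ω : Path 𝒳) (n m : ℕ) (x : 𝒳) (s : ℕ → 𝒳) : ℝ :=
  (cnt ω (m + 1) (withLast x s) ((half n : ℤ) + (m : ℤ)) (n : ℤ) : ℝ) /
    (cnt ω m s ((half n : ℤ) + (m : ℤ) - 1) ((n : ℤ) - 1) : ℝ)

/-- The empirical statistic `Δ̂_k^n(X̃_{-k+1}^0)`. -/
def hatDelta (γ : ℝ) (l : ℕ → ℕ) (ω : Path 𝒳) (n k : ℕ) : ℝ :=
  (if zeta l ω (Jfun l k) ≤ (half n : ℤ) - 1 then (1 : ℝ) else 0) *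
    sSup {d : ℝ | ∃ i : ℕ, 1 ≤ i ∧ i ≤ n ∧ ∃ z : ℕ → 𝒳, ∃ x : 𝒳,
      inL γ ω n (k + i) (withLast x (prependOld (tildePast l ω) k z)) ∧
      d = |empCond ω n k x (tildePast l ω) -
            empCond ω n (k + i) x (prependOld (tildePast l ω) k z)|}

/-- The order estimate `χ_n`: the smallest `0 ≤ k < n` with `Δ̂_k^n ≤ n^{-β}`
(and `χ_0 = 0`). -/
def chi (β γ : ℝ) (l : ℕ → ℕ) (ω : Path 𝒳) (n : ℕ) : ℕ :=
  sInf {k : ℕ | k < n ∧ hatDelta γ l ω n k ≤ (n : ℝ) ^ (-β)}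

/-- The index `j` with `ζ_j ≤ v < ζ_{j+1}`. -/
def jIndex (l : ℕ → ℕ) (ω : Path 𝒳) (v : ℤ) : ℕ := sInf {j : ℕ | v < zeta l ω (j + 1)}

/-- The stopping times `λ_n`:  `λ_0 = 0` and, if `ζ_j ≤ λ_{n-1} < ζ_{j+1}`,
`λ_n = min { t > λ_{n-1} : X_{t - χ_t + 1}^t = X_{ζ_j - χ_t + 1}^{ζ_j} }`. -/
def lambda (β γ : ℝ) (l : ℕ → ℕ) (ω : Path 𝒳) : ℕ → ℤ
  | 0 => 0
  | n + 1 =>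
    lambda β γ l ω n + 1 +
      ((sInf {s : ℕ |
          ∀ r < chi β γ l ω (lambda β γ l ω n + 1 + (s : ℤ)).toNat,
            ω (lambda β γ l ω n + 1 + (s : ℤ) - (r : ℤ)) =
              ω (zeta l ω (jIndex l ω (lambda β γ l ω n)) - (r : ℤ))} : ℕ) : ℤ)

/-- `κ_n = χ_{λ_n}`. -/
def kappa (β γ : ℝ) (l : ℕ → ℕ) (ω : Path 𝒳) (n : ℕ) : ℕ :=
  chi β γ l ω (lambda β γ l ω n).toNat

/-- The estimator `f_n = (1/n) ∑_{j=0}^{n-1} f(X_{λ_j + 1})`. -/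
def fEst (β γ : ℝ) (l : ℕ → ℕ) (f : 𝒳 → ℝ) (ω : Path 𝒳) (n : ℕ) : ℝ :=
  (1 / (n : ℝ)) * ∑ j ∈ Finset.range n, f (ω (lambda β γ l ω j + 1))

open Classical in
/-- The metric `d*` on one-sided sequences. -/
def dstar (x y : ℕ → 𝒳) : ℝ :=
  ∑' i : ℕ, (2 : ℝ)⁻¹ ^ (i + 1) * (if x i ≠ y i then 1 else 0)

/-- `F` restricted to `C` is continuous with respect to the metric `d*`. -/
def ContinuousOnDstar (F : (ℕ → 𝒳) → ℝ) (C : Set (ℕ → 𝒳)) : Prop :=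
  ∀ x ∈ C, ∀ ε > 0, ∃ δ > 0, ∀ y ∈ C, dstar x y < δ → |F y - F x| < ε

/-- The σ-algebra generated by the one-sided past `X^0_{-∞}`. -/
def pastSigma (𝒳 : Type*) [MeasurableSpace 𝒳] : MeasurableSpace (Path 𝒳) :=
  MeasurableSpace.comap past inferInstance

/-- `F` is a version of the conditional expectation `E(f(X_1) | X^0_{-∞})`. -/
def IsPredictor (μ : Measure (Path 𝒳)) (f : 𝒳 → ℝ) (F : (ℕ → 𝒳) → ℝ) : Prop :=
  (fun ω => F (past ω)) =ᵐ[μ] μ[fun ω => f (ω 1)|pastSigma 𝒳]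

/-- `F` (a version of `E(f(X_1)|X^0_{-∞})`) is almost surely continuous:
it is continuous w.r.t. `d*` on a set of paths of probability one. -/
def ASContinuousCondExp (μ : Measure (Path 𝒳)) (F : (ℕ → 𝒳) → ℝ) : Prop :=
  ∃ C : Set (ℕ → 𝒳), μ (past ⁻¹' C) = 1 ∧ ContinuousOnDstar F C

/-- The observation `(λ_j, X_0^{λ_j})`, encoding the data segment available at
time `λ_j` (values before time `0` are clamped to `X_0`). -/
def segObs (β γ : ℝ) (l : ℕ → ℕ) (j : ℕ) (ω : Path 𝒳) : ℤ × (ℕ → 𝒳) :=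
  (lambda β γ l ω j, fun i => ω (max (lambda β γ l ω j - (i : ℤ)) 0))

/-- The σ-algebra generated by `(λ_j, X_0^{λ_j})`. -/
def segSigma (β γ : ℝ) (l : ℕ → ℕ) (j : ℕ) : MeasurableSpace (Path 𝒳) :=
  MeasurableSpace.comap (segObs β γ l j) inferInstance

/-- The observation `(λ_j, X_{-∞}^{λ_j})`: the full past at time `λ_j`. -/
def fullPastObs (β γ : ℝ) (l : ℕ → ℕ) (j : ℕ) (ω : Path 𝒳) : ℤ × (ℕ → 𝒳) :=
  (lambda β γ l ω j, fun i => ω (lambda β γ l ω j - (i : ℤ)))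

/-- The σ-algebra generated by `(λ_j, X_{-∞}^{λ_j})`. -/
def fullPastSigma (β γ : ℝ) (l : ℕ → ℕ) (j : ℕ) : MeasurableSpace (Path 𝒳) :=
  MeasurableSpace.comap (fullPastObs β γ l j) inferInstance

/-- The `n`-th term `-(1/(n+1)) ∑ p log₂ p` of the entropy rate. -/
def entropyTerm (μ : Measure (Path 𝒳)) (n : ℕ) : ℝ :=
  -(1 / ((n : ℝ) + 1)) *
    ∑' s : Fin (n + 1) → 𝒳,
      pstr μ (n + 1) (fun j => if h : j < n + 1 then s ⟨j, h⟩ else s ⟨0, Nat.succ_pos n⟩) *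
        Real.logb 2
          (pstr μ (n + 1) (fun j => if h : j < n + 1 then s ⟨j, h⟩ else s ⟨0, Nat.succ_pos n⟩))

/-- The process has entropy rate `H`. -/
def HasEntropyRate (μ : Measure (Path 𝒳)) (H : ℝ) : Prop :=
  Tendsto (entropyTerm μ) atTop (nhds H)

/-- The backward stopping times `ζ̂_i^k`. -/
def hatZeta (l : ℕ → ℕ) (k : ℕ) (ω : Path 𝒳) : ℕ → ℤ
  | 0 => 0
  | i + 1 =>
    hatZeta l k ω i -
      ((sInf {t : ℕ | 0 < t ∧ ∀ s < l (k - i),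
          ω (hatZeta l k ω i - (s : ℤ) - (t : ℤ)) = ω (hatZeta l k ω i - (s : ℤ))} : ℕ) : ℤ)


section Deterministic

variable {𝒳 : Type*}

theorem sInf_eq_sInf_of_forall_le {A B : Set ℕ} (hA : A.Nonempty)
    (h : ∀ u ≤ sInf A, u ∈ A ↔ u ∈ B) : sInf B = sInf A := by
  have hB : sInf A ∈ B := (h _ le_rfl).1 (Nat.sInf_mem hA)
  refine le_antisymm (Nat.sInf_le hB) (Nat.sInf_le ?_)
  exact (h _ (Nat.sInf_le hB)).2 (Nat.sInf_mem ⟨_, hB⟩)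

/-- Every finite block of `ω` ending at a nonnegative time occurs again later. -/
def Recurrent (ω : Path 𝒳) : Prop :=
  ∀ t : ℕ, ∀ m : ℕ, ∃ u : ℕ, 0 < u ∧ ∀ s < m, ω ((t : ℤ) - (s : ℤ) + (u : ℤ)) = ω (t - (s : ℤ))

/-- `ω` and `ω'` agree on the time interval `[0, t]`. -/
def AgreeUpTo (t : ℤ) (ω ω' : Path 𝒳) : Prop := ∀ i : ℤ, 0 ≤ i → i ≤ t → ω i = ω' i

theorem AgreeUpTo.symm {t : ℤ} {ω ω' : Path 𝒳} (h : AgreeUpTo t ω ω') : AgreeUpTo t ω' ω :=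
  fun i h0 h1 => (h i h0 h1).symm

theorem AgreeUpTo.mono {s t : ℤ} {ω ω' : Path 𝒳} (h : AgreeUpTo t ω ω') (hst : s ≤ t) :
    AgreeUpTo s ω ω' := fun i h0 h1 => h i h0 (h1.trans hst)

variable {l : ℕ → ℕ} {ω ω' : Path 𝒳} {β γ : ℝ}

theorem zeta_succ (l : ℕ → ℕ) (ω : Path 𝒳) (n : ℕ) : zeta l ω (n + 1) = zeta l ω n +
      ((sInf {t : ℕ | 0 < t ∧ ∀ s < l (n + 1),
          ω (zeta l ω n - (s : ℤ) + (t : ℤ)) = ω (zeta l ω n - (s : ℤ))} : ℕ) : ℤ) := rfl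

theorem zeta_nonneg (l : ℕ → ℕ) (ω : Path 𝒳) (n : ℕ) : 0 ≤ zeta l ω n := by
  induction n with
  | zero => exact le_rfl
  | succ n ih => rw [zeta_succ]; positivity

theorem Recurrent.zeta_set_nonempty (hω : Recurrent ω) (n m : ℕ) :
    {t : ℕ | 0 < t ∧ ∀ s < m,
      ω (zeta l ω n - (s : ℤ) + (t : ℤ)) = ω (zeta l ω n - (s : ℤ))}.Nonempty := by
  obtain ⟨z, hz⟩ := Int.eq_ofNat_of_zero_le (zeta_nonneg l ω n)
  rw [hz]
  exact hω z m

theorem Recurrent.zeta_lt_succ (hω : Recurrent ω) (n : ℕ) :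
    zeta l ω n < zeta l ω (n + 1) := by
  have h := (Nat.sInf_mem (hω.zeta_set_nonempty (l := l) n (l (n + 1)))).1
  rw [zeta_succ]
  omega

theorem Recurrent.apply_zeta_succ (hω : Recurrent ω) {n s : ℕ} (hs : s < l (n + 1)) :
    ω (zeta l ω (n + 1) - s) = ω (zeta l ω n - s) := by
  have h := (Nat.sInf_mem (hω.zeta_set_nonempty (l := l) n (l (n + 1)))).2 s hs
  rw [← h, zeta_succ]
  congr 1
  ring

theorem Recurrent.zeta_strictMono (hω : Recurrent ω) : StrictMono (zeta l ω) :=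
  strictMono_nat_of_lt_succ hω.zeta_lt_succ

theorem Recurrent.le_zeta (hω : Recurrent ω) (n : ℕ) : (n : ℤ) ≤ zeta l ω n := by
  induction n with
  | zero => exact le_rfl
  | succ n ih => have := hω.zeta_lt_succ (l := l) n; push_cast; omega

theorem Recurrent.apply_zeta_eq (hω : Recurrent ω) (hlmono : Monotone l) {n m i : ℕ}
    (hnm : n ≤ m) (hi : i < l (n + 1)) : ω (zeta l ω m - i) = ω (zeta l ω n - i) := by
  induction m, hnm using Nat.le_induction with
  | base => rfl
  | succ m hm ih =>
    rw [hω.apply_zeta_succ (hi.trans_le (hlmono (by omega))), ih]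

theorem Jfun_spec (hltop : Tendsto l atTop atTop) (n : ℕ) :
    1 ≤ Jfun l n ∧ n < l (Jfun l n + 1) := by
  have hne : {j : ℕ | 1 ≤ j ∧ n < l (j + 1)}.Nonempty := by
    have h1 : ∀ᶠ j in atTop, n < l (j + 1) :=
      ((tendsto_add_atTop_iff_nat 1).2 hltop).eventually_gt_atTop n
    exact ((eventually_ge_atTop 1).and h1).exists
  exact Nat.sInf_mem hne

theorem Jfun_mono (hltop : Tendsto l atTop atTop) {i k : ℕ} (hik : i ≤ k) :
    Jfun l i ≤ Jfun l k :=
  Nat.sInf_le ⟨(Jfun_spec hltop k).1, hik.trans_lt (Jfun_spec hltop k).2⟩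

theorem le_Jfun (hltop : Tendsto l atTop atTop) (hlle : ∀ k, 1 ≤ k → l k ≤ k) (i : ℕ) :
    i ≤ Jfun l i := by
  have h1 := (Jfun_spec hltop i).2
  have h2 := hlle (Jfun l i + 1) (by omega)
  omega

theorem Recurrent.tildePast_eq (hω : Recurrent ω) (hlmono : Monotone l)
    (hltop : Tendsto l atTop atTop) {n i : ℕ} (hi : i < l (n + 1)) :
    tildePast l ω i = ω (zeta l ω n - i) := by
  unfold tildePast
  rcases le_total (Jfun l i) n with h | h
  · exact (hω.apply_zeta_eq hlmono h (Jfun_spec hltop i).2).symm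
  · exact hω.apply_zeta_eq hlmono h hi

theorem chi_le (β γ : ℝ) (l : ℕ → ℕ) (ω : Path 𝒳) (n : ℕ) : chi β γ l ω n ≤ n := by
  unfold chi
  rcases Set.eq_empty_or_nonempty
    {k : ℕ | k < n ∧ hatDelta γ l ω n k ≤ (n : ℝ) ^ (-β)} with h | h
  · simp [h]
  · exact (Nat.sInf_mem h).1.le

theorem Recurrent.chi_le_of_le_zeta (hω : Recurrent ω) (hlmono : Monotone l)
    (hltop : Tendsto l atTop atTop) {t j : ℕ} (ht : (t : ℤ) ≤ zeta l ω (j + 1)) :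
    chi β γ l ω t ≤ l (j + 1) := by
  rcases le_or_gt t (l (j + 1)) with h | h
  · exact (chi_le β γ l ω t).trans h
  refine Nat.sInf_le ⟨h, ?_⟩
  have hJ : j + 1 ≤ Jfun l (l (j + 1)) := by
    by_contra hcon
    have h1 := (Jfun_spec hltop (l (j + 1))).2
    have h2 : l (Jfun l (l (j + 1)) + 1) ≤ l (j + 1) := hlmono (by omega)
    omega
  have h3 : zeta l ω (j + 1) ≤ zeta l ω (Jfun l (l (j + 1))) :=
    hω.zeta_strictMono.monotone hJ
  have h4 : ¬ zeta l ω (Jfun l (l (j + 1))) ≤ (half t : ℤ) - 1 := by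
    unfold half
    omega
  unfold hatDelta
  rw [if_neg h4, zero_mul]
  positivity

theorem lambda_succ (β γ : ℝ) (l : ℕ → ℕ) (ω : Path 𝒳) (n : ℕ) :
    lambda β γ l ω (n + 1) = lambda β γ l ω n + 1 +
      ((sInf {s : ℕ |
          ∀ r < chi β γ l ω (lambda β γ l ω n + 1 + (s : ℤ)).toNat,
            ω (lambda β γ l ω n + 1 + (s : ℤ) - (r : ℤ)) =
              ω (zeta l ω (jIndex l ω (lambda β γ l ω n)) - (r : ℤ))} : ℕ) : ℤ) := rfl

theorem lambda_nonneg (β γ : ℝ) (l : ℕ → ℕ) (ω : Path 𝒳) (n : ℕ) :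
    0 ≤ lambda β γ l ω n := by
  induction n with
  | zero => exact le_rfl
  | succ n ih => rw [lambda_succ]; positivity

theorem Recurrent.jIndex_spec (hω : Recurrent ω) {v : ℤ} (hv : 0 ≤ v) :
    zeta l ω (jIndex l ω v) ≤ v ∧ v < zeta l ω (jIndex l ω v + 1) := by
  have hne : {j : ℕ | v < zeta l ω (j + 1)}.Nonempty := by
    refine ⟨v.toNat, ?_⟩
    have := hω.le_zeta (l := l) (v.toNat + 1)
    simp only [mem_ofPred_eq]
    omega
  refine ⟨?_, Nat.sInf_mem hne⟩
  rcases Nat.eq_zero_or_pos (jIndex l ω v) with h | h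
  · rw [h]; exact hv
  · have h1 : jIndex l ω v - 1 ∉ {j : ℕ | v < zeta l ω (j + 1)} :=
      Nat.notMem_of_lt_sInf (by unfold jIndex at h ⊢; omega)
    simp only [mem_ofPred_eq, not_lt] at h1
    rwa [Nat.sub_add_cancel h] at h1

theorem Recurrent.lambda_set_mem (hω : Recurrent ω) (hlmono : Monotone l)
    (hltop : Tendsto l atTop atTop) (n : ℕ) :
    (zeta l ω (jIndex l ω (lambda β γ l ω n) + 1) - (lambda β γ l ω n + 1)).toNat ∈ {s : ℕ |
          ∀ r < chi β γ l ω (lambda β γ l ω n + 1 + (s : ℤ)).toNat,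
            ω (lambda β γ l ω n + 1 + (s : ℤ) - (r : ℤ)) =
              ω (zeta l ω (jIndex l ω (lambda β γ l ω n)) - (r : ℤ))} := by
  have hj := hω.jIndex_spec (l := l) (lambda_nonneg β γ l ω n)
  set j := jIndex l ω (lambda β γ l ω n)
  have h0 := zeta_nonneg l ω (j + 1)
  have he : lambda β γ l ω n + 1 +
      (((zeta l ω (j + 1) - (lambda β γ l ω n + 1)).toNat : ℕ) : ℤ) = zeta l ω (j + 1) := by
    omega
  simp only [mem_ofPred_eq]
  rw [he]
  intro r hr
  exact hω.apply_zeta_succ (hr.trans_le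
    (hω.chi_le_of_le_zeta hlmono hltop (by omega)))

theorem Recurrent.lambda_succ_le (hω : Recurrent ω) (hlmono : Monotone l)
    (hltop : Tendsto l atTop atTop) (n : ℕ) :
    lambda β γ l ω (n + 1) ≤ zeta l ω (jIndex l ω (lambda β γ l ω n) + 1) := by
  have h := Nat.sInf_le (hω.lambda_set_mem (β := β) (γ := γ) hlmono hltop n)
  have hj := hω.jIndex_spec (l := l) (lambda_nonneg β γ l ω n)
  rw [lambda_succ]
  omega

theorem Recurrent.apply_lambda_succ (hω : Recurrent ω) (hlmono : Monotone l)
    (hltop : Tendsto l atTop atTop) (n r : ℕ) (hr : r < kappa β γ l ω (n + 1)) :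
    ω (lambda β γ l ω (n + 1) - r) = ω (zeta l ω (jIndex l ω (lambda β γ l ω n)) - r) := by
  have h := Nat.sInf_mem ⟨_, hω.lambda_set_mem (β := β) (γ := γ) hlmono hltop n⟩
  unfold kappa at hr
  rw [lambda_succ] at hr ⊢
  exact h r hr

theorem Recurrent.kappa_succ_le (hω : Recurrent ω) (hlmono : Monotone l)
    (hltop : Tendsto l atTop atTop) (n : ℕ) :
    kappa β γ l ω (n + 1) ≤ l (jIndex l ω (lambda β γ l ω n) + 1) := by
  have h := hω.lambda_succ_le (β := β) (γ := γ) hlmono hltop n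
  have h0 := lambda_nonneg β γ l ω (n + 1)
  exact hω.chi_le_of_le_zeta hlmono hltop (by omega)

theorem Recurrent.tildePast_eq_apply_lambda (hω : Recurrent ω) (hlmono : Monotone l)
    (hltop : Tendsto l atTop atTop) (j r : ℕ) (hr : r < kappa β γ l ω j) :
    tildePast l ω r = ω (lambda β γ l ω j - r) := by
  cases j with
  | zero =>
    have := chi_le β γ l ω 0
    unfold kappa lambda at hr
    simp only [Int.toNat_zero] at hr
    omega
  | succ n =>
    rw [hω.apply_lambda_succ hlmono hltop n r hr]
    exact hω.tildePast_eq hlmono hltop (hr.trans_le (hω.kappa_succ_le hlmono hltop n))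

theorem AgreeUpTo.zeta_eq (hω : Recurrent ω) (hlle : ∀ k, 1 ≤ k → l k ≤ k) {t : ℤ}
    (h : AgreeUpTo t ω ω') {n : ℕ} (hn : zeta l ω n ≤ t) : zeta l ω' n = zeta l ω n := by
  induction n with
  | zero => rfl
  | succ n ih =>
    have hz := ih ((hω.zeta_lt_succ n).le.trans hn)
    rw [zeta_succ] at hn
    rw [zeta_succ, zeta_succ, hz]
    congr 2
    refine sInf_eq_sInf_of_forall_le (hω.zeta_set_nonempty n _) fun u hu => ?_
    refine and_congr_right fun _ => forall₂_congr fun s hs => ?_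
    have h1 := hlle (n + 1) (by omega)
    have h2 := hω.le_zeta (l := l) n
    rw [h _ (by omega) (by omega), h (zeta l ω n - s) (by omega) (by omega)]

theorem AgreeUpTo.zeta_le_iff (hω : Recurrent ω) (hω' : Recurrent ω')
    (hlle : ∀ k, 1 ≤ k → l k ≤ k) {s t : ℤ} (h : AgreeUpTo t ω ω') (hst : s ≤ t) (n : ℕ) :
    zeta l ω n ≤ s ↔ zeta l ω' n ≤ s :=
  ⟨fun hn => by rwa [h.zeta_eq hω hlle (hn.trans hst)],
    fun hn => by rwa [h.symm.zeta_eq hω' hlle (hn.trans hst)]⟩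

theorem cnt_congr {t : ℤ} (h : AgreeUpTo t ω ω') {m : ℕ} {s s' : ℕ → 𝒳}
    (hs : ∀ j < m, s j = s' j) {a b : ℤ} (ha : (m : ℤ) - 1 ≤ a) (hb : b ≤ t) :
    cnt ω m s a b = cnt ω' m s' a b := by
  classical
  unfold cnt
  congr 1
  refine Finset.filter_congr fun u hu => ?_
  rw [Finset.mem_Icc] at hu
  refine forall₂_congr fun j hj => ?_
  rw [hs j hj, h (u - j) (by omega) (by omega)]

theorem inL_congr {n m : ℕ} (h : AgreeUpTo n ω ω') (s : ℕ → 𝒳) :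
    inL γ ω n m s ↔ inL γ ω' n m s := by
  have h1 : (half n : ℤ) - 1 ≤ n := by unfold half; omega
  refine and_congr ?_ ?_
  · refine exists_congr fun t => and_congr_right fun hm => and_congr_right fun ht => ?_
    refine forall₂_congr fun j hj => ?_
    rw [h (t - j) (by omega) (by omega)]
  · unfold inL2
    rw [cnt_congr h (fun _ _ => rfl) (by push_cast; omega) le_rfl]

theorem empCond_congr {n m : ℕ} (h : AgreeUpTo n ω ω') (x : 𝒳) {s s' : ℕ → 𝒳}
    (hs : ∀ j < m, s j = s' j) : empCond ω n m x s = empCond ω' n m x s' := by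
  unfold empCond
  congr 2
  · refine cnt_congr h (fun j hj => ?_) (by push_cast; omega) le_rfl
    unfold withLast
    split_ifs with h0
    · rfl
    · exact hs _ (by omega)
  · exact cnt_congr h hs (by omega) (by omega)

theorem hatDelta_congr {n k : ℕ} (h : AgreeUpTo n ω ω')
    (hz : zeta l ω (Jfun l k) ≤ (half n : ℤ) - 1 ↔ zeta l ω' (Jfun l k) ≤ (half n : ℤ) - 1)
    (ht : zeta l ω (Jfun l k) ≤ (half n : ℤ) - 1 →
      ∀ i < k, tildePast l ω i = tildePast l ω' i) :
    hatDelta γ l ω n k = hatDelta γ l ω' n k := by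
  unfold hatDelta
  by_cases hc : zeta l ω (Jfun l k) ≤ (half n : ℤ) - 1
  · have ht := ht hc
    rw [if_pos hc, if_pos (hz.1 hc)]
    congr 2
    ext d
    simp only [mem_ofPred_eq]
    refine exists_congr fun i => and_congr_right fun _ => and_congr_right fun _ =>
      exists_congr fun z => exists_congr fun x => ?_
    have hp : prependOld (tildePast l ω) k z = prependOld (tildePast l ω') k z := by
      funext j
      unfold prependOld
      split_ifs with hj
      · exact ht j hj
      · rfl
    rw [hp, inL_congr h, empCond_congr h x ht,
      empCond_congr h x (s := prependOld (tildePast l ω') k z) (fun _ _ => rfl)]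
  · rw [if_neg hc, if_neg (fun h' => hc (hz.2 h')), zero_mul, zero_mul]

theorem chi_congr {n : ℕ} (h : AgreeUpTo n ω ω')
    (hz : ∀ k < n,
      (zeta l ω (Jfun l k) ≤ (half n : ℤ) - 1 ↔ zeta l ω' (Jfun l k) ≤ (half n : ℤ) - 1))
    (ht : ∀ k < n, zeta l ω (Jfun l k) ≤ (half n : ℤ) - 1 →
      ∀ i < k, tildePast l ω i = tildePast l ω' i) :
    chi β γ l ω n = chi β γ l ω' n := by
  unfold chi
  congr 1
  ext k
  refine and_congr_right fun hk => ?_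
  rw [hatDelta_congr h (hz k hk) (ht k hk)]

theorem AgreeUpTo.chi_eq (hω : Recurrent ω) (hω' : Recurrent ω')
    (hlle : ∀ k, 1 ≤ k → l k ≤ k) (hltop : Tendsto l atTop atTop)
    {n : ℕ} (h : AgreeUpTo n ω ω') : chi β γ l ω n = chi β γ l ω' n := by
  have h1 : (half n : ℤ) - 1 ≤ n := by unfold half; omega
  refine chi_congr h (fun k _ => h.zeta_le_iff hω hω' hlle h1 _) fun k _ hk i hi => ?_
  have h2 : zeta l ω (Jfun l i) ≤ n :=
    (hω.zeta_strictMono.monotone (Jfun_mono hltop hi.le)).trans (hk.trans h1)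
  have h3 := hω.le_zeta (l := l) (Jfun l i)
  have h4 := le_Jfun hltop hlle i
  unfold tildePast
  rw [h.zeta_eq hω hlle h2]
  exact h _ (by omega) (by omega)

theorem AgreeUpTo.jIndex_eq (hω : Recurrent ω) (hω' : Recurrent ω')
    (hlle : ∀ k, 1 ≤ k → l k ≤ k) {v : ℤ} (h : AgreeUpTo v ω ω') :
    jIndex l ω v = jIndex l ω' v := by
  unfold jIndex
  congr 1
  ext j
  simp only [mem_ofPred_eq, ← not_le]
  rw [h.zeta_le_iff hω hω' hlle le_rfl]

/-- `λ_n` is a stopping time on recurrent paths. -/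
theorem AgreeUpTo.lambda_eq (hω : Recurrent ω) (hω' : Recurrent ω') (hlmono : Monotone l)
    (hlle : ∀ k, 1 ≤ k → l k ≤ k) (hltop : Tendsto l atTop atTop)
    {t : ℤ} (h : AgreeUpTo t ω ω') {n : ℕ} (hn : lambda β γ l ω n ≤ t) :
    lambda β γ l ω' n = lambda β γ l ω n := by
  induction n with
  | zero => rfl
  | succ n ih =>
    have hle := hω.lambda_succ_le (β := β) (γ := γ) hlmono hltop n
    rw [lambda_succ] at hn hle
    have hv := ih (by omega)
    have hv0 := lambda_nonneg β γ l ω n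
    have hj := hω.jIndex_spec (l := l) hv0
    rw [lambda_succ, lambda_succ, hv,
      ← (h.mono (s := lambda β γ l ω n) (by omega)).jIndex_eq hω hω' hlle,
      h.zeta_eq hω hlle (hj.1.trans (by omega))]
    set j := jIndex l ω (lambda β γ l ω n) with hjdef
    congr 2
    refine sInf_eq_sInf_of_forall_le ⟨_, hω.lambda_set_mem hlmono hltop n⟩ fun u hu => ?_
    have ha : AgreeUpTo ((lambda β γ l ω n + 1 + (u : ℤ)).toNat : ℕ) ω ω' :=
      h.mono (by omega)
    simp only [mem_ofPred_eq]
    rw [← ha.chi_eq hω hω' hlle hltop]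
    refine forall₂_congr fun r hr => ?_
    have h1 := hr.trans_le (chi_le _ _ _ _ _)
    have h2 := hr.trans_le
      (hω.chi_le_of_le_zeta (j := j) hlmono hltop (by omega))
    have h3 := hlle (j + 1) (by omega)
    have h4 := hω.le_zeta (l := l) j
    rw [h _ (by omega) (by omega), h (zeta l ω j - r) (by omega) (by omega)]

end Deterministic

section Measurability

variable {𝒳 : Type*} [MeasurableSpace 𝒳] {Ω : Type*} [MeasurableSpace Ω]

theorem measurable_apply_of_measurable {X : Ω → Path 𝒳} (hX : Measurable X) {N : Ω → ℤ}
    (hN : Measurable N) : Measurable fun ω => X ω (N ω) := by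
  have h : Measurable fun p : Path 𝒳 × ℤ => p.1 p.2 :=
    measurable_from_prod_countable_left fun i => measurable_pi_apply i
  exact h.comp (hX.prodMk hN)

theorem measurable_past : Measurable (past : Path 𝒳 → ℕ → 𝒳) :=
  measurable_pi_lambda _ fun _ => measurable_pi_apply _

variable [Countable 𝒳] [MeasurableSingletonClass 𝒳]

theorem measurable_eq_of_countable {α : Type*} [Countable α] [MeasurableSpace α]
    [MeasurableSingletonClass α] {a b : Ω → α} (ha : Measurable a) (hb : Measurable b) :
    Measurable fun ω => a ω = b ω :=
  measurableSet_setOfPred.1 ((ha.prodMk hb) (t := {p | p.1 = p.2}) (Set.to_countable _).measurableSet)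

theorem measurable_sInf_setOf {p : Ω → ℕ → Prop} (hp : ∀ n, Measurable fun ω => p ω n) :
    Measurable fun ω => sInf {n | p ω n} := by
  refine measurable_to_countable' fun n => ?_
  have h : (fun ω => sInf {n | p ω n}) ⁻¹' {n} =
      {ω | (p ω n ∧ ∀ m < n, ¬ p ω m) ∨ (n = 0 ∧ ∀ m, ¬ p ω m)} := by
    ext ω
    simp only [mem_preimage, mem_singleton_iff, mem_ofPred_eq]
    constructor
    · rintro rfl
      rcases Set.eq_empty_or_nonempty {n | p ω n} with h | h
      · refine Or.inr ⟨by simp [h], fun m hm => ?_⟩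
        have : m ∈ {n | p ω n} := hm
        simp [h] at this
      · exact Or.inl ⟨Nat.sInf_mem h, fun m hm => Nat.notMem_of_lt_sInf hm⟩
    · rintro (⟨h1, h2⟩ | ⟨h1, h2⟩)
      · refine le_antisymm (Nat.sInf_le h1) ?_
        by_contra hcon
        exact h2 _ (not_le.1 hcon) (Nat.sInf_mem ⟨n, h1⟩)
      · simp [h1, h2]
  rw [h, measurableSet_setOfPred]
  refine ((hp n).and (Measurable.forall fun m => ?_)).or
    (measurable_const.and (Measurable.forall fun m => (hp m).not))
  exact measurable_const.imp (hp m).not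

theorem measurable_of_factorsThrough {α β : Type*} [Countable β] [MeasurableSpace β]
    [MeasurableSingletonClass β] [MeasurableSpace α] {g : Ω → α} {φ : Ω → β}
    (hφ : Measurable φ) (h : ∀ ω ω', φ ω = φ ω' → g ω = g ω') : Measurable g := by
  intro s _
  have : g ⁻¹' s = φ ⁻¹' (φ '' (g ⁻¹' s)) := by
    refine subset_antisymm (subset_preimage_image _ _) ?_
    rintro ω ⟨ω', h', he⟩
    rw [mem_preimage, ← h _ _ he]
    exact h'
  rw [this]
  exact hφ (Set.to_countable _).measurableSet

theorem measurable_zeta (l : ℕ → ℕ) (n : ℕ) :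
    Measurable fun ω : Path 𝒳 => zeta l ω n := by
  induction n with
  | zero => exact measurable_const
  | succ n ih =>
    simp only [zeta_succ]
    refine ih.add (Measurable.comp (measurable_from_top (f := fun n : ℕ => (n : ℤ)))
      (measurable_sInf_setOf fun t => ?_))
    refine measurable_const.and (Measurable.forall fun s => measurable_const.imp ?_)
    exact measurable_eq_of_countable
      (measurable_apply_of_measurable measurable_id ((ih.sub_const _).add_const _))
      (measurable_apply_of_measurable measurable_id (ih.sub_const _))

theorem measurable_tildePast_apply (l : ℕ → ℕ) (i : ℕ) :
    Measurable fun ω : Path 𝒳 => tildePast l ω i :=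
  measurable_apply_of_measurable measurable_id ((measurable_zeta l _).sub_const _)

theorem measurable_tildePast (l : ℕ → ℕ) :
    Measurable fun ω : Path 𝒳 => tildePast l ω :=
  measurable_pi_lambda _ fun i => measurable_tildePast_apply l i

theorem measurable_chi (β γ : ℝ) (l : ℕ → ℕ) (n : ℕ) :
    Measurable fun ω : Path 𝒳 => chi β γ l ω n := by
  refine measurable_of_factorsThrough
    (φ := fun ω : Path 𝒳 => ((fun i : Fin (n + 1) => ω (i : ℕ)),
      (fun k : Fin n => zeta l ω (Jfun l k)), (fun k : Fin n => tildePast l ω k)))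
    ?_ fun ω ω' h => ?_
  · refine Measurable.prodMk ?_ (Measurable.prodMk ?_ ?_)
    · exact measurable_pi_lambda _ fun i => measurable_pi_apply _
    · exact measurable_pi_lambda _ fun i => measurable_zeta l _
    · exact measurable_pi_lambda _ fun i => measurable_tildePast_apply l _
  · simp only [Prod.mk.injEq, funext_iff] at h
    obtain ⟨h1, h2, h3⟩ := h
    refine chi_congr (fun i h0 hi => ?_) (fun k hk => ?_) fun k hk _ i hi => ?_
    · have := h1 ⟨i.toNat, by omega⟩
      simpa [Int.toNat_of_nonneg h0] using this
    · rw [h2 ⟨k, hk⟩]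
    · exact h3 ⟨i, hi.trans hk⟩

theorem measurable_comp_of_countable {α ι : Type*} [Countable ι] [MeasurableSpace ι]
    [MeasurableSingletonClass ι] [MeasurableSpace α] {g : Ω → ι → α}
    (hg : ∀ i, Measurable fun ω => g ω i) {N : Ω → ι} (hN : Measurable N) :
    Measurable fun ω => g ω (N ω) := by
  have h : Measurable fun p : Ω × ι => g p.1 p.2 :=
    measurable_from_prod_countable_left fun i => hg i
  exact h.comp (measurable_id.prodMk hN)

theorem measurable_lambda (β γ : ℝ) (l : ℕ → ℕ) (n : ℕ) :
    Measurable fun ω : Path 𝒳 => lambda β γ l ω n := by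
  induction n with
  | zero => exact measurable_const
  | succ n ih =>
    simp only [lambda_succ]
    refine (ih.add_const 1).add (Measurable.comp (measurable_from_top (f := fun n : ℕ => (n : ℤ)))
      (measurable_sInf_setOf fun s => Measurable.forall fun r => Measurable.imp ?_ ?_))
    · have h := measurable_comp_of_countable (measurable_chi (𝒳 := 𝒳) β γ l)
        (Measurable.comp (measurable_from_top (f := Int.toNat))
          ((ih.add_const 1).add_const (s : ℤ)))
      exact Measurable.comp (measurable_from_top (f := fun m : ℕ => r < m)) h
    · refine measurable_eq_of_countable
        (measurable_apply_of_measurable measurable_id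
          (((ih.add_const 1).add_const _).sub_const _))
        (measurable_apply_of_measurable measurable_id (Measurable.sub_const ?_ _))
      refine measurable_comp_of_countable (measurable_zeta l) (measurable_sInf_setOf fun j => ?_)
      exact measurableSet_setOfPred.1 (measurableSet_lt ih (measurable_zeta l _))

theorem measurable_segObs (β γ : ℝ) (l : ℕ → ℕ) (j : ℕ) :
    Measurable (segObs (𝒳 := 𝒳) β γ l j) := by
  refine (measurable_lambda β γ l j).prodMk (measurable_pi_lambda _ fun i => ?_)
  exact measurable_apply_of_measurable measurable_id
    (((measurable_lambda β γ l j).sub_const _).max measurable_const)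

end Measurability

section Stationarity

theorem shift_iterate_apply {𝒳 : Type*} (n : ℕ) (ω : Path 𝒳) (i : ℤ) :
    shift^[n] ω i = ω (i + n) := by
  induction n generalizing ω with
  | zero => simp
  | succ n ih =>
    rw [Function.iterate_succ_apply, ih]
    unfold shift
    congr 1
    push_cast
    ring

variable {𝒳 : Type*} [Countable 𝒳] [MeasurableSpace 𝒳] [MeasurableSingletonClass 𝒳]
  {μ : Measure (Path 𝒳)} [IsProbabilityMeasure μ]

theorem ae_recurrent (hμ : MeasurePreserving (shift : Path 𝒳 → Path 𝒳) μ μ) :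
    ∀ᵐ ω ∂μ, Recurrent ω := by
  have h1 : ∀ᵐ ω ∂μ, ∀ m : ℕ, ∃ u : ℕ, 0 < u ∧
      ∀ s < m, ω (-(s : ℤ) + (u : ℤ)) = ω (-(s : ℤ)) := by
    rw [ae_all_iff]
    intro m
    have h2 : ∀ᵐ ω ∂μ, ∀ b : Fin m → 𝒳,
        ω ∈ {ω : Path 𝒳 | (fun i : Fin m => ω (-((i : ℕ) : ℤ))) = b} →
        ∃ᶠ n in atTop, shift^[n] ω ∈ {ω : Path 𝒳 | (fun i : Fin m => ω (-((i : ℕ) : ℤ))) = b} := by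
      rw [ae_all_iff]
      intro b
      refine hμ.conservative.ae_mem_imp_frequently_image_mem (MeasurableSet.nullMeasurableSet ?_)
      have : Measurable fun ω : Path 𝒳 => fun i : Fin m => ω (-((i : ℕ) : ℤ)) :=
        measurable_pi_lambda _ fun _ => measurable_pi_apply _
      exact this (measurableSet_singleton b)
    filter_upwards [h2] with ω hω
    obtain ⟨u, hu, hu0⟩ := ((hω _ rfl).and_eventually (eventually_gt_atTop 0)).exists
    refine ⟨u, hu0, fun s hs => ?_⟩
    have := congr_fun hu ⟨s, hs⟩
    simpa [shift_iterate_apply] using this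
  have h2 : ∀ᵐ ω ∂μ, ∀ t : ℕ, ∀ m : ℕ, ∃ u : ℕ, 0 < u ∧
      ∀ s < m, (shift^[t] ω) (-(s : ℤ) + (u : ℤ)) = (shift^[t] ω) (-(s : ℤ)) :=
    ae_all_iff.2 fun t => (hμ.iterate t).quasiMeasurePreserving.ae h1
  filter_upwards [h2] with ω hω t m
  obtain ⟨u, hu0, hu⟩ := hω t m
  refine ⟨u, hu0, fun s hs => ?_⟩
  have := hu s hs
  simp only [shift_iterate_apply] at this
  convert this using 2 <;> ring

/-- The first recurrence time of the block of length `m` ending at time `0`. -/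
def returnTime (m : ℕ) (ω : Path 𝒳) : ℕ :=
  sInf {u : ℕ | 0 < u ∧ ∀ s < m, ω (-(s : ℤ) + (u : ℤ)) = ω (-(s : ℤ))}

/-- The shift by the first recurrence time of the block of length `m` ending at time `0`. -/
def returnMap (m : ℕ) (ω : Path 𝒳) : Path 𝒳 := fun i => ω (i + returnTime m ω)

theorem measurable_returnMap (m : ℕ) : Measurable (returnMap m : Path 𝒳 → Path 𝒳) := by
  refine measurable_pi_lambda _ fun i => measurable_apply_of_measurable measurable_id
    (Measurable.const_add (Measurable.comp (measurable_from_top (f := fun n : ℕ => (n : ℤ)))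
      (measurable_sInf_setOf fun u => ?_)) i)
  exact measurable_const.and (Measurable.forall fun s => measurable_const.imp
    (measurable_eq_of_countable (measurable_pi_apply _) (measurable_pi_apply _)))

theorem measurePreserving_returnMap (hμ : MeasurePreserving (shift : Path 𝒳 → Path 𝒳) μ μ)
    (m : ℕ) : MeasurePreserving (returnMap m : Path 𝒳 → Path 𝒳) μ μ := by
  have hT := measurable_returnMap (𝒳 := 𝒳) m
  refine ⟨hT, ?_⟩
  have := Measure.isProbabilityMeasure_map (μ := μ) hT.aemeasurable
  refine Measure.eq_of_le_of_isProbabilityMeasure (Measure.le_iff.2 fun B hB => ?_)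
  rw [Measure.map_apply hT hB]
  let E : ℕ → Set (Path 𝒳) := fun u => {ω | 0 < u ∧ (∀ s < m, ω (-(s : ℤ)) = ω (-(s : ℤ) - u)) ∧
    ∀ v : ℕ, 0 < v → v < u → ¬ ∀ s < m, ω (-(s : ℤ)) = ω (-(s : ℤ) - v)}
  have hE : ∀ u, MeasurableSet (E u) := by
    intro u
    have hb : ∀ v : ℕ, Measurable fun ω : Path 𝒳 => ∀ s < m, ω (-(s : ℤ)) = ω (-(s : ℤ) - v) :=
      fun v => Measurable.forall fun s => measurable_const.imp
        (measurable_eq_of_countable (measurable_pi_apply _) (measurable_pi_apply _))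
    exact measurableSet_setOfPred.2 (measurable_const.and ((hb u).and (Measurable.forall fun v =>
      measurable_const.imp (measurable_const.imp (hb v).not))))
  have hdisj : Pairwise (Function.onFun Disjoint fun u => E u ∩ B) := by
    have hlt : ∀ u v, u < v → ∀ ω, ω ∈ E u → ω ∉ E v :=
      fun u v huv ω hu hv => hv.2.2 u hu.1 huv hu.2.1
    intro u v huv
    refine Set.disjoint_left.2 fun ω hu hv => ?_
    rcases lt_or_gt_of_ne huv with h | h
    · exact hlt u v h ω hu.1 hv.1
    · exact hlt v u h ω hv.1 hu.1
  have hsub : returnMap m ⁻¹' B ≤ᵐ[μ] ⋃ u : ℕ, shift^[u] ⁻¹' (E u ∩ B) := by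
    filter_upwards [ae_recurrent hμ] with ω hω hB'
    obtain ⟨v, hv⟩ := hω 0 m
    have hmem := Nat.sInf_mem (s := {u : ℕ | 0 < u ∧
      ∀ s < m, ω (-(s : ℤ) + (u : ℤ)) = ω (-(s : ℤ))}) ⟨v, by simpa using hv⟩
    refine mem_iUnion.2 ⟨returnTime m ω, ⟨hmem.1, fun s hs => ?_, fun v hv0 hv hcon => ?_⟩, ?_⟩
    · simp only [shift_iterate_apply]
      rw [sub_add_cancel]
      exact hmem.2 s hs
    · refine Nat.notMem_of_lt_sInf (m := returnTime m ω - v) (show _ < returnTime m ω by omega)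
        ⟨by omega, fun s hs => ?_⟩
      have h1 := hcon s hs
      simp only [shift_iterate_apply] at h1
      have h2 : ω (-(s : ℤ) + (returnTime m ω : ℕ)) = ω (-(s : ℤ)) := hmem.2 s hs
      rw [← h2, h1]
      congr 1
      push_cast [hv.le]
      ring
    · have : shift^[returnTime m ω] ω = returnMap m ω :=
        funext fun i => shift_iterate_apply _ _ _
      rw [this]
      exact hB'
  calc μ (returnMap m ⁻¹' B) ≤ μ (⋃ u : ℕ, shift^[u] ⁻¹' (E u ∩ B)) := measure_mono_ae hsub
    _ ≤ ∑' u : ℕ, μ (shift^[u] ⁻¹' (E u ∩ B)) := measure_iUnion_le _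
    _ = ∑' u : ℕ, μ (E u ∩ B) := by
      congr 1
      funext u
      exact (hμ.iterate u).measure_preimage ((hE u).inter hB).nullMeasurableSet
    _ = μ (⋃ u, E u ∩ B) := (measure_iUnion hdisj fun u => (hE u).inter hB).symm
    _ ≤ μ B := measure_mono (iUnion_subset fun u => inter_subset_right)

theorem measurePreserving_shift_zeta (hμ : MeasurePreserving (shift : Path 𝒳 → Path 𝒳) μ μ)
    (l : ℕ → ℕ) (n : ℕ) :
    MeasurePreserving (fun ω : Path 𝒳 => (fun i => ω (i + zeta l ω n) : Path 𝒳)) μ μ := by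
  induction n with
  | zero =>
    have : (fun ω : Path 𝒳 => (fun i => ω (i + zeta l ω 0) : Path 𝒳)) = id := by
      funext ω i
      simp [zeta]
    rw [this]
    exact MeasurePreserving.id μ
  | succ n ih =>
    convert (measurePreserving_returnMap hμ (l (n + 1))).comp ih using 1
    funext ω i
    simp only [Function.comp, returnMap]
    rw [zeta_succ]
    unfold returnTime
    have : ∀ (s : ℕ) (t : ℕ), zeta l ω n - (s : ℤ) + (t : ℤ) = -(s : ℤ) + t + zeta l ω n :=
      fun _ _ => by ring
    have h' : ∀ (s : ℕ), zeta l ω n - (s : ℤ) = -(s : ℤ) + zeta l ω n := fun _ => by ring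
    simp only [this]
    simp only [h']
    congr 1
    ring

/-- The auxiliary past `X̃` has the same distribution as the past `X⁰_{-∞}`. -/
theorem map_tildePast (hμ : MeasurePreserving (shift : Path 𝒳 → Path 𝒳) μ μ) {l : ℕ → ℕ}
    (hlmono : Monotone l) (hltop : Tendsto l atTop atTop) :
    μ.map (fun ω => tildePast l ω) = μ.map past := by
  have hm := measurable_tildePast (𝒳 := 𝒳) l
  have hp := measurable_past (𝒳 := 𝒳)
  have h2 : IsProjectiveLimit (μ.map past) fun I : Finset ℕ => (μ.map past).map I.restrict :=
    fun I => rfl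
  have := Measure.isProbabilityMeasure_map (μ := μ) hp.aemeasurable
  have (I : Finset ℕ) : IsFiniteMeasure ((μ.map past).map (I.restrict (π := fun _ => 𝒳))) :=
    inferInstance
  refine IsProjectiveLimit.unique (fun I => ?_) h2
  rw [Measure.map_map (Finset.measurable_restrict I) hm,
    Measure.map_map (Finset.measurable_restrict I) hp]
  set n := Jfun l (I.sup id) with hn
  have hz := measurePreserving_shift_zeta hμ l n
  conv_rhs => rw [← hz.map_eq]
  rw [Measure.map_map ((Finset.measurable_restrict I).comp hp) hz.measurable]
  refine Measure.map_congr ?_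
  filter_upwards [ae_recurrent hμ] with ω hω
  funext i
  have hi : (i : ℕ) ≤ I.sup id := Finset.le_sup (f := id) i.2
  have := hω.tildePast_eq hlmono hltop (hi.trans_lt (Jfun_spec hltop (I.sup id)).2)
  simp only [Function.comp, Finset.restrict, past]
  rw [this]
  congr 1
  ring

end Stationarity

section Predictor

/-- A property of `X` holding almost surely holds almost surely for the law of `X`, even when it is
not measurable. -/
theorem ae_map_of_ae {Ω P : Type*} [MeasurableSpace Ω] [StandardBorelSpace Ω] [MeasurableSpace P]
    [MeasurableEq P] {μ : Measure Ω} [IsProbabilityMeasure μ] {X : Ω → P} (hX : Measurable X)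
    {p : P → Prop} (h : ∀ᵐ ω ∂μ, p (X ω)) : ∀ᵐ x ∂(μ.map X), p x := by
  have : Nonempty Ω := μ.nonempty_of_neZero
  have hm : Measurable fun ω => (X ω, ω) := hX.prodMk measurable_id
  let ρ : Measure (P × Ω) := μ.map fun ω => (X ω, ω)
  have : IsProbabilityMeasure ρ := Measure.isProbabilityMeasure_map hm.aemeasurable
  have hfst : ρ.fst = μ.map X := by
    rw [Measure.fst, Measure.map_map measurable_fst hm]
    rfl
  have h1 : ∀ᵐ z ∂ρ, p (X z.2) ∧ z.1 = X z.2 := by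
    have hN : {z : P × Ω | z.2 ∈ toMeasurable μ {ω | ¬ p (X ω)}}ᶜ ∩ {z | z.1 = X z.2} ∈ ae ρ := by
      refine mem_ae_map_iff hm.aemeasurable ?_ |>.2 ?_
      · exact (measurable_snd (measurableSet_toMeasurable _ _)).compl.inter
          (measurableSet_eq_fun measurable_fst (hX.comp measurable_snd))
      · have h0 : μ (toMeasurable μ {ω | ¬ p (X ω)}) = 0 := by
          rw [measure_toMeasurable]
          exact ae_iff.1 h
        filter_upwards [measure_eq_zero_iff_ae_notMem.1 h0] with ω hω
        exact ⟨hω, rfl⟩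
    filter_upwards [hN] with z hz
    refine ⟨?_, hz.2⟩
    by_contra hcon
    exact hz.1 (subset_toMeasurable _ _ hcon)
  rw [← ρ.disintegrate ρ.condKernel, hfst] at h1
  filter_upwards [Measure.ae_ae_of_ae_compProd h1] with x hx
  obtain ⟨ω, hω, he⟩ := hx.exists
  exact he ▸ hω

theorem dstar_le_of_forall_lt {𝒳 : Type*} {x y : ℕ → 𝒳} {N : ℕ} (h : ∀ i < N, x i = y i) :
    dstar x y ≤ (2 : ℝ)⁻¹ ^ N := by
  classical
  unfold dstar
  have hg : Summable fun i : ℕ => (2 : ℝ)⁻¹ ^ (i + 1) :=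
    (summable_nat_add_iff 1).2 (summable_geometric_of_lt_one (by norm_num) (by norm_num))
  have hle : ∀ i : ℕ, (2 : ℝ)⁻¹ ^ (i + 1) * (if x i ≠ y i then 1 else 0) ≤ (2 : ℝ)⁻¹ ^ (i + 1) :=
    fun i => mul_le_of_le_one_right (by positivity) (by split_ifs <;> norm_num)
  have hs : Summable fun i : ℕ => (2 : ℝ)⁻¹ ^ (i + 1) * (if x i ≠ y i then (1 : ℝ) else 0) :=
    hg.of_nonneg_of_le (fun i => by positivity) hle
  rw [← hs.sum_add_tsum_nat_add N, Finset.sum_eq_zero, zero_add]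
  · calc _ ≤ ∑' i : ℕ, (2 : ℝ)⁻¹ ^ (i + N + 1) :=
          ((summable_nat_add_iff N).2 hs).tsum_le_tsum (fun i => hle _)
            ((summable_nat_add_iff N).2 hg)
      _ = ∑' i : ℕ, (2 : ℝ)⁻¹ ^ i * (2 : ℝ)⁻¹ ^ (N + 1) := by
          congr 1; funext i; rw [← pow_add]; rfl
      _ = (2 : ℝ)⁻¹ ^ N := by
          rw [tsum_mul_right, tsum_geometric_of_lt_one (by norm_num) (by norm_num), pow_succ]
          ring
  · intro i hi
    simp [h i (Finset.mem_range.1 hi)]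

/-- Almost every path has only cylinders of positive probability. -/
theorem ae_agreeUpTo_pos {𝒳 : Type*} [Countable 𝒳] [MeasurableSpace 𝒳] {μ : Measure (Path 𝒳)} :
    ∀ᵐ ω ∂μ, ∀ t : ℕ, μ {ω' | AgreeUpTo (t : ℤ) ω ω'} ≠ 0 := by
  rw [ae_all_iff]
  intro t
  let φ : Path 𝒳 → Fin (t + 1) → 𝒳 := fun ω i => ω (i : ℕ)
  have h : ∀ᵐ ω ∂μ, ∀ b : Fin (t + 1) → 𝒳, μ (φ ⁻¹' {b}) = 0 → ω ∉ φ ⁻¹' {b} := by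
    rw [ae_all_iff]
    intro b
    by_cases hb : μ (φ ⁻¹' {b}) = 0
    · filter_upwards [measure_eq_zero_iff_ae_notMem.1 hb] with ω hω _ using hω
    · exact Eventually.of_forall fun ω h => absurd h hb
  filter_upwards [h] with ω hω h0
  have hsub : φ ⁻¹' {φ ω} ⊆ {ω' | AgreeUpTo (t : ℤ) ω ω'} := ?_
  · exact hω (φ ω) (measure_mono_null hsub h0) rfl
  intro ω' hω' i h1 h2
  have := congr_fun hω' ⟨i.toNat, by omega⟩
  simp only [φ, Int.toNat_of_nonneg h1] at this
  exact this.symm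

variable {𝒳 : Type*} [Countable 𝒳] [MeasurableSpace 𝒳] [MeasurableSingletonClass 𝒳]
  {μ : Measure (Path 𝒳)} [IsProbabilityMeasure μ] {f : 𝒳 → ℝ} {F g : (ℕ → 𝒳) → ℝ}

/-- An almost surely continuous `F` that agrees almost surely with a measurable `g` is essentially
continuous at almost every past. -/
theorem ae_essentially_continuous (hg : Measurable g)
    (hFg : ∀ᵐ ω ∂μ, F (past ω) = g (past ω)) (hFcont : ASContinuousCondExp μ F) :
    ∀ᵐ x ∂(μ.map past), ∀ k : ℕ, ∃ N : ℕ, ∀ᵐ y ∂(μ.map past),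
      (∀ i < N, y i = x i) → |g y - g x| < 1 / ((k : ℝ) + 1) := by
  have hp := measurable_past (𝒳 := 𝒳)
  have := Measure.isProbabilityMeasure_map (μ := μ) hp.aemeasurable
  set ν := μ.map past
  obtain ⟨C, hC, hcont⟩ := hFcont
  have hnull : ∀ M : Set (ℕ → 𝒳), MeasurableSet M → (∀ x ∈ C, F x = g x → x ∉ M) → ν M = 0 := by
    intro M hM hdisj
    rw [Measure.map_apply hp hM]
    have h1 : μ (past ⁻¹' C) ≤ μ (past ⁻¹' M)ᶜ := by
      refine measure_mono_ae ?_
      filter_upwards [hFg] with ω hω hωC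
      exact hdisj _ hωC hω
    rw [hC, prob_compl_eq_one_sub (hp hM)] at h1
    by_contra hne
    exact absurd h1 (not_le.2 (ENNReal.sub_lt_self ENNReal.one_ne_top one_ne_zero hne))
  have hbad : ∀ k N : ℕ, MeasurableSet {z : (ℕ → 𝒳) × (ℕ → 𝒳) |
      (∀ i < N, z.2 i = z.1 i) ∧ ¬ |g z.2 - g z.1| < 1 / ((k : ℝ) + 1)} := by
    intro k N
    refine measurableSet_setOfPred.2 (Measurable.and (Measurable.forall fun i =>
      measurable_const.imp (measurable_eq_of_countable
        ((measurable_pi_apply i).comp measurable_snd)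
        ((measurable_pi_apply i).comp measurable_fst))) (Measurable.not ?_))
    exact measurableSet_setOfPred.1 (measurableSet_lt
      ((hg.comp measurable_snd).sub (hg.comp measurable_fst)).abs measurable_const)
  have hae : ∀ (k N : ℕ) (x : ℕ → 𝒳),
      (∀ᵐ y ∂ν, (∀ i < N, y i = x i) → |g y - g x| < 1 / ((k : ℝ) + 1)) ↔
      ν (Prod.mk x ⁻¹' {z : (ℕ → 𝒳) × (ℕ → 𝒳) |
        (∀ i < N, z.2 i = z.1 i) ∧ ¬ |g z.2 - g z.1| < 1 / ((k : ℝ) + 1)}) = 0 := by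
    intro k N x
    rw [ae_iff]
    simp only [Classical.not_imp]
    rfl
  simp only [hae]
  have hgood : Measurable fun x => ∀ k : ℕ, ∃ N : ℕ, ν (Prod.mk x ⁻¹' {z : (ℕ → 𝒳) × (ℕ → 𝒳) |
        (∀ i < N, z.2 i = z.1 i) ∧ ¬ |g z.2 - g z.1| < 1 / ((k : ℝ) + 1)}) = 0 :=
    Measurable.forall fun k => Measurable.exists fun N => measurableSet_setOfPred.1
      (measurable_measure_prodMk_left (hbad k N) (measurableSet_singleton 0))
  refine hnull _ (measurableSet_setOfPred.2 hgood).compl fun x hx hxg hcon => hcon fun k => ?_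
  obtain ⟨δ, hδ, hclose⟩ := hcont x hx (1 / ((k : ℝ) + 1)) (by positivity)
  obtain ⟨N, hN⟩ := exists_pow_lt_of_lt_one hδ (show (2 : ℝ)⁻¹ < 1 by norm_num)
  refine ⟨N, hnull _ (measurable_prodMk_left (hbad k N)) fun y hy hyg hmem => hmem.2 ?_⟩
  have h := hclose y hy ((dstar_le_of_forall_lt fun i hi => (hmem.1 i hi).symm).trans_lt hN)
  rwa [hyg, hxg] at h

theorem measurableSet_agreeUpTo (t : ℤ) (ω : Path 𝒳) :
    MeasurableSet {ω' | AgreeUpTo t ω ω'} :=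
  measurableSet_setOfPred.2 (Measurable.forall fun i => measurable_const.imp
    (measurable_const.imp (measurable_eq_of_countable measurable_const (measurable_pi_apply i))))

theorem setIntegral_agreeUpTo (hμ : MeasurePreserving (shift : Path 𝒳 → Path 𝒳) μ μ)
    (hf : ∃ M, ∀ x, |f x| ≤ M) (hg : Measurable g)
    (hgf : (fun ω => g (past ω)) =ᵐ[μ] μ[fun ω => f (ω 1)|pastSigma 𝒳]) (t : ℕ) (ω : Path 𝒳) :
    ∫ ω' in {ω' | AgreeUpTo (t : ℤ) ω ω'}, f (ω' (t + 1)) ∂μ =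
      ∫ ω' in {ω' | AgreeUpTo (t : ℤ) ω ω'}, g (past (shift^[t] ω')) ∂μ := by
  obtain ⟨M, hM⟩ := hf
  have hp := measurable_past (𝒳 := 𝒳)
  have hfm : Measurable f := measurable_of_countable f
  have hf1 : Measurable fun ω : Path 𝒳 => f (ω 1) := hfm.comp (measurable_pi_apply 1)
  let B : Set (ℕ → 𝒳) := {z | ∀ i ≤ t, ω ((t : ℤ) - i) = z i}
  have hB : MeasurableSet B := measurableSet_setOfPred.2 (Measurable.forall fun i =>
    measurable_const.imp (measurable_eq_of_countable measurable_const (measurable_pi_apply i)))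
  have hK : {ω' | AgreeUpTo (t : ℤ) ω ω'} = shift^[t] ⁻¹' (past ⁻¹' B) := by
    ext ω'
    simp only [mem_ofPred_eq, mem_preimage, B, past, shift_iterate_apply]
    constructor
    · intro h i hi
      rw [h _ (by omega) (by omega)]
      congr 1
      ring
    · intro h i h0 h1
      have h2 := h (t - i.toNat) (by omega)
      have h3 : (t : ℤ) - ((t - i.toNat : ℕ) : ℤ) = i := by omega
      have h4 : -((t - i.toNat : ℕ) : ℤ) + t = i := by omega
      rwa [h3, h4] at h2
  have ht := hμ.iterate t
  have hm : pastSigma 𝒳 ≤ (inferInstance : MeasurableSpace (Path 𝒳)) := hp.comap_le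
  have key : ∫ ω' in past ⁻¹' B, f (ω' 1) ∂μ = ∫ ω' in past ⁻¹' B, g (past ω') ∂μ := by
    rw [← setIntegral_condExp hm (Integrable.of_bound hf1.aestronglyMeasurable M
      (Eventually.of_forall fun ω => hM _)) ⟨B, hB, rfl⟩]
    exact integral_congr_ae (ae_restrict_of_ae hgf.symm)
  have e1 : ∀ h : Path 𝒳 → ℝ, Measurable h →
      ∫ ω' in past ⁻¹' B, h ω' ∂μ = ∫ ω' in shift^[t] ⁻¹' (past ⁻¹' B), h (shift^[t] ω') ∂μ := by
    intro h hh
    conv_lhs => rw [← ht.map_eq]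
    exact setIntegral_map (hp hB) hh.aestronglyMeasurable ht.measurable.aemeasurable
  rw [hK, ← e1 (fun ω => g (past ω)) (hg.comp hp), ← key, e1 _ hf1]
  simp only [shift_iterate_apply]
  congr 1
  funext ω'
  rw [add_comm]

theorem abs_condExp_segSigma_sub_le {β γ : ℝ} {l : ℕ → ℕ}
    (hμ : MeasurePreserving (shift : Path 𝒳 → Path 𝒳) μ μ) (hlmono : Monotone l)
    (hlle : ∀ k, 1 ≤ k → l k ≤ k) (hltop : Tendsto l atTop atTop)
    (hf : ∃ M, ∀ x, |f x| ≤ M) (hg : Measurable g)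
    (hgf : (fun ω => g (past ω)) =ᵐ[μ] μ[fun ω => f (ω 1)|pastSigma 𝒳])
    {ω : Path 𝒳} (hω : Recurrent ω) {j t : ℕ} (ht : lambda β γ l ω j = t)
    (hpos : μ {ω' | AgreeUpTo (t : ℤ) ω ω'} ≠ 0) {c ε : ℝ}
    (hc : ∀ᵐ ω' ∂μ, AgreeUpTo (t : ℤ) ω ω' → |g (past (shift^[t] ω')) - c| ≤ ε) :
    |(μ[fun ω' => f (ω' (lambda β γ l ω' j + 1))|segSigma β γ l j]) ω - c| ≤ ε := by
  have hm : segSigma β γ l j ≤ (inferInstance : MeasurableSpace (Path 𝒳)) :=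
    (measurable_segObs β γ l j).comap_le
  have hfm : Measurable f := measurable_of_countable f
  have hY : Measurable fun ω' : Path 𝒳 => f (ω' (lambda β γ l ω' j + 1)) :=
    hfm.comp (measurable_apply_of_measurable measurable_id
      ((measurable_lambda β γ l j).add_const 1))
  set Y := fun ω' : Path 𝒳 => f (ω' (lambda β γ l ω' j + 1)) with hYdef
  set K := {ω' | AgreeUpTo (t : ℤ) ω ω'} with hKdef
  have hKm : MeasurableSet K := measurableSet_agreeUpTo _ ω
  let A : Set (Path 𝒳) := segObs β γ l j ⁻¹' {segObs β γ l j ω}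
  have hA : MeasurableSet[segSigma β γ l j] A := ⟨_, measurableSet_singleton _, rfl⟩
  have hAK : A =ᵐ[μ] K := by
    filter_upwards [ae_recurrent hμ] with ω' hω'
    refine propext ⟨fun h i h0 hi => ?_, fun h => ?_⟩
    · have h1 : segObs β γ l j ω' = segObs β γ l j ω := h
      simp only [segObs, Prod.mk.injEq] at h1
      have h2 := congr_fun h1.2 (t - i.toNat)
      have h3 : max ((t : ℤ) - ((t - i.toNat : ℕ) : ℤ)) 0 = i := by omega
      rw [h1.1, ht, h3] at h2
      exact h2.symm
    · have h' : AgreeUpTo (t : ℤ) ω ω' := h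
      have h1 : lambda β γ l ω' j = lambda β γ l ω j :=
        h'.lambda_eq hω hω' hlmono hlle hltop ht.le
      refine Prod.ext h1 (funext fun i => ?_)
      simp only [segObs, h1, ht]
      exact (h' _ (by omega) (by omega)).symm
  obtain ⟨M, hM⟩ := hf
  have hYint : Integrable Y μ := Integrable.of_bound hY.aestronglyMeasurable M
    (Eventually.of_forall fun ω => hM _)
  have hconst : ∀ ω' ∈ A, (μ[Y|segSigma β γ l j]) ω' = (μ[Y|segSigma β γ l j]) ω := by
    intro ω' hω'
    have : StronglyMeasurable[segSigma β γ l j] (μ[Y|segSigma β γ l j]) :=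
      stronglyMeasurable_condExp
    obtain ⟨h, -, hh⟩ := this.exists_eq_measurable_comp
    rw [hh]
    exact congr_arg h hω'
  have hI1 : ∫ ω' in A, Y ω' ∂μ = μ.real K * (μ[Y|segSigma β γ l j]) ω := by
    rw [← setIntegral_condExp hm hYint hA, setIntegral_congr_fun (hm _ hA) hconst,
      setIntegral_const, measureReal_congr hAK, smul_eq_mul]
  have hI2 : ∫ ω' in A, Y ω' ∂μ = ∫ ω' in K, g (past (shift^[t] ω')) ∂μ := by
    rw [← setIntegral_agreeUpTo hμ ⟨M, hM⟩ hg hgf, setIntegral_congr_set hAK]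
    refine setIntegral_congr_ae hKm ?_
    filter_upwards [ae_recurrent hμ] with ω' hω' h
    have h1 : lambda β γ l ω' j = lambda β γ l ω j :=
      AgreeUpTo.lambda_eq hω hω' hlmono hlle hltop h ht.le
    simp only [hYdef, h1, ht]
  have hgint : Integrable (fun ω' => g (past (shift^[t] ω'))) μ :=
    (hμ.iterate t).integrable_comp_of_integrable (integrable_condExp.congr hgf.symm)
  have hbound := norm_setIntegral_le_of_norm_le_const_ae' (μ := μ) (s := K)
    (f := fun ω' => g (past (shift^[t] ω')) - c) (C := ε) (measure_lt_top μ K) hc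
  rw [integral_sub hgint.integrableOn (integrable_const c), ← hI2, hI1, setIntegral_const,
    smul_eq_mul, ← mul_sub, norm_mul, Real.norm_of_nonneg measureReal_nonneg,
    mul_comm ε] at hbound
  have hKpos : 0 < μ.real K := ENNReal.toReal_pos hpos (measure_ne_top _ _)
  exact le_of_mul_le_mul_left hbound hKpos

end Predictor

/-- Step 3, infinite memory case. If `F` is almost surely
continuous and `κ_j → ∞` almost surely, then almost surely `X̃⁰_{-∞}` lies in
every random neighbourhood `𝒩_j(X_0^{λ_j})` and
`|E(f(X_{λ_j+1}) | X_0^{λ_j}) - F(X̃⁰_{-∞})| → 0`. -/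
theorem statement18
    {𝒳 : Type*} [Countable 𝒳] [MeasurableSpace 𝒳] [MeasurableSingletonClass 𝒳]
    (μ : Measure (Path 𝒳)) [IsProbabilityMeasure μ]
    (hErg : Ergodic (shift : Path 𝒳 → Path 𝒳) μ)
    (l : ℕ → ℕ) (hl1 : l 1 = 1) (hlmono : Monotone l)
    (hlle : ∀ k, 1 ≤ k → l k ≤ k) (hltop : Tendsto l atTop atTop)
    (β γ : ℝ) (hγ0 : 0 < γ) (hγ1 : γ < 1) (hβ0 : 0 < β) (hβγ : 2 * β + γ < 1)
    (f : 𝒳 → ℝ) (hf : ∃ M, ∀ x, |f x| ≤ M)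
    (F : (ℕ → 𝒳) → ℝ) (hF : IsPredictor μ f F)
    (hFcont : ASContinuousCondExp μ F)
    (hκ : ∀ᵐ ω ∂μ, Tendsto (fun j => kappa β γ l ω j) atTop atTop) :
    ∀ᵐ ω ∂μ,
      (∀ j : ℕ, tildePast l ω ∈
        {z : ℕ → 𝒳 | ∀ r < kappa β γ l ω j, z r = ω (lambda β γ l ω j - (r : ℤ))}) ∧
      Tendsto (fun j =>
          |(μ[fun ω' => f (ω' (lambda β γ l ω' j + 1))|segSigma β γ l j]) ω -
            F (tildePast l ω)|) atTop (nhds 0) := by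
  have hμ := hErg.toMeasurePreserving
  have hp := measurable_past (𝒳 := 𝒳)
  obtain ⟨g, hg, hgf⟩ : ∃ g : (ℕ → 𝒳) → ℝ, StronglyMeasurable g ∧
      μ[fun ω => f (ω 1)|pastSigma 𝒳] = g ∘ past :=
    StronglyMeasurable.exists_eq_measurable_comp stronglyMeasurable_condExp
  have hgf' : (fun ω => g (past ω)) =ᵐ[μ] μ[fun ω => f (ω 1)|pastSigma 𝒳] := by rw [hgf]; rfl
  have hFg : ∀ᵐ ω ∂μ, F (past ω) = g (past ω) := by
    filter_upwards [hF, hgf'] with ω h1 h2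
    rw [h1, h2]
  have hgood := (ae_map_of_ae (p := fun x => F x = g x) hp hFg).and (ae_essentially_continuous hg.measurable hFg hFcont)
  rw [← map_tildePast hμ hlmono hltop] at hgood
  filter_upwards [ae_recurrent hμ, ae_agreeUpTo_pos (μ := μ), hκ,
    ae_of_ae_map (measurable_tildePast l).aemeasurable hgood] with ω hω hpos hκω hX
  have hmem := hω.tildePast_eq_apply_lambda (β := β) (γ := γ) hlmono hltop
  refine ⟨fun j r hr => hmem j r hr, ?_⟩
  rw [Metric.tendsto_atTop']
  intro ε hε
  obtain ⟨k, hk⟩ := exists_nat_one_div_lt hε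
  obtain ⟨N, hN⟩ := hX.2 k
  rw [map_tildePast hμ hlmono hltop] at hN
  obtain ⟨n, hn⟩ := eventually_atTop.1 (hκω.eventually_ge_atTop N)
  refine ⟨n, fun j hj => ?_⟩
  obtain ⟨t, ht⟩ := Int.eq_ofNat_of_zero_le (lambda_nonneg β γ l ω j)
  have hκt : kappa β γ l ω j ≤ t := by
    have := chi_le β γ l ω (lambda β γ l ω j).toNat
    unfold kappa
    omega
  rw [Real.dist_0_eq_abs, abs_abs, hX.1]
  refine lt_of_le_of_lt (abs_condExp_segSigma_sub_le hμ hlmono hlle hltop hf hg.measurable hgf' hω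
    ht (hpos t) ?_) hk
  filter_upwards [(hμ.iterate t).quasiMeasurePreserving.ae (ae_of_ae_map hp.aemeasurable hN)]
    with ω' hω' hagree
  refine (hω' fun i hi => ?_).le
  have hiκ := hi.trans_le (hn j hj.le)
  rw [hmem j i hiκ, ht, hagree _ (by omega) (by omega)]
  simp only [past, shift_iterate_apply]
  congr 1
  ring

end MWPrediction
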